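/- arXiv:1401.2042 — 3 statements merged into one kernel-verified Lean document; each statement's English description precedes it below -/
import Mathlib

section
/- Let α = (α_n)_{n≥0} be a real sequence such that the Hankel operator Γ_α is bounded on ℓ², Γ_α ≥ 0, and Γ_{S*α} ≥ 0. Then (1/2)·sup_{n≥0}(n+1)|α_n| ≤ ‖Γ_α‖, where ‖Γ_α‖ is the operator norm. -/
open scoped ComplexInnerProductSpace ComplexOrder ENNReal NNReal
open MeasureTheory Filter

noncomputable section

abbrev ℓ2 : Type := lp (fun _ : ℕ => ℂ) 2

def e (n : ℕ) : ℓ2 := lp.single 2 n 1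

def IsHankelOp (α : ℕ → ℝ) (Γ : ℓ2 →L[ℂ] ℓ2) : Prop :=
  ∀ n m : ℕ, ⟪Γ (e n), e m⟫ = (α (n + m) : ℂ)

def PosOp (Γ : ℓ2 →L[ℂ] ℓ2) : Prop := ∀ x : ℓ2, 0 ≤ ⟪Γ x, x⟫

def MemL1infPP (α : ℕ → ℝ) (Γ ΓS : ℓ2 →L[ℂ] ℓ2) : Prop :=
  (∃ C : ℝ, ∀ n : ℕ, (n + 1 : ℝ) * |α n| ≤ C) ∧
  IsHankelOp α Γ ∧ IsHankelOp (fun n => α (n + 1)) ΓS ∧ PosOp Γ ∧ PosOp ΓS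
theorem inner_e_e (n m : ℕ) : ⟪e n, e m⟫ = if n = m then 1 else 0 := by
  unfold e
  rw [lp.inner_single_left]
  by_cases h : n = m
  · subst h; simp
  · simp [h]

theorem PosOp.nonneg_of_isHankelOp {α : ℕ → ℝ} {Γ : ℓ2 →L[ℂ] ℓ2} (hΓ : IsHankelOp α Γ)
    (hpos : PosOp Γ) (k : ℕ) : 0 ≤ α (k + k) := by
  have h := hpos (e k)
  rw [hΓ] at h
  exact_mod_cast h

theorem PosOp.convex_of_isHankelOp {α : ℕ → ℝ} {Γ : ℓ2 →L[ℂ] ℓ2} (hΓ : IsHankelOp α Γ)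
    (hpos : PosOp Γ) (k : ℕ) :
    2 * α (k + k + 1) ≤ α (k + k) + α (k + k + 2) := by
  have h := hpos (e k - e (k + 1))
  rw [map_sub, inner_sub_left, inner_sub_right, inner_sub_right, hΓ, hΓ, hΓ, hΓ] at h
  have h' : 0 ≤ α (k + k) - α (k + (k + 1)) - (α (k + 1 + k) - α (k + 1 + (k + 1))) := by
    exact_mod_cast h
  rw [show k + (k + 1) = k + k + 1 by ring, show k + 1 + k = k + k + 1 by ring,
    show k + 1 + (k + 1) = k + k + 2 by ring] at h'
  linarith

theorem two_mul_le_add_of_convex {α : ℕ → ℝ} (h : ∀ n, 2 * α (n + 1) ≤ α n + α (n + 2))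
    (d n : ℕ) : 2 * α (n + d) ≤ α n + α (n + 2 * d) := by
  have hmono : Monotone fun n => α (n + 1) - α n := by
    refine monotone_nat_of_le_succ fun n => ?_
    have := h n
    simp only [add_assoc, Nat.reduceAdd]
    linarith
  induction d generalizing n with
  | zero => simp [two_mul]
  | succ d ih =>
    have h1 := ih (n + 1)
    have h2 := hmono (show n ≤ n + 2 * d + 1 by omega)
    simp only at h2
    rw [show n + 1 + d = n + (d + 1) by ring, show n + 1 + 2 * d = n + 2 * d + 1 by ring] at h1
    rw [show n + 2 * (d + 1) = n + 2 * d + 1 + 1 by ring]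
    linarith

theorem two_mul_le_add_of_convex_of_add_eq {α : ℕ → ℝ}
    (h : ∀ n, 2 * α (n + 1) ≤ α n + α (n + 2)) {N a b : ℕ} (hab : a + b = 2 * N) :
    2 * α N ≤ α a + α b := by
  rcases le_total a N with ha | ha
  · have := two_mul_le_add_of_convex h (N - a) a
    rwa [show a + (N - a) = N by omega, show a + 2 * (N - a) = b by omega] at this
  · have := two_mul_le_add_of_convex h (N - b) b
    rw [show b + (N - b) = N by omega, show b + 2 * (N - b) = a by omega] at this
    linarith

theorem sq_mul_le_sum_of_convex {α : ℕ → ℝ} (h : ∀ n, 2 * α (n + 1) ≤ α n + α (n + 2))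
    (N : ℕ) : ((N : ℝ) + 1) ^ 2 * α N ≤
      ∑ j ∈ Finset.range (N + 1), ∑ k ∈ Finset.range (N + 1), α (j + k) := by
  have hrefl : ∑ j ∈ Finset.range (N + 1), ∑ k ∈ Finset.range (N + 1), α ((N - j) + (N - k)) =
      ∑ j ∈ Finset.range (N + 1), ∑ k ∈ Finset.range (N + 1), α (j + k) := by
    rw [← Finset.sum_range_reflect (fun j => ∑ k ∈ Finset.range (N + 1), α (j + k))]
    refine Finset.sum_congr rfl fun j _ => ?_
    rw [← Finset.sum_range_reflect (fun k => α (N + 1 - 1 - j + k))]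
    rfl
  have hsum : ∑ _j ∈ Finset.range (N + 1), ∑ _k ∈ Finset.range (N + 1), 2 * α N ≤
      ∑ j ∈ Finset.range (N + 1), ∑ k ∈ Finset.range (N + 1),
        (α (j + k) + α ((N - j) + (N - k))) := by
    refine Finset.sum_le_sum fun j hj => Finset.sum_le_sum fun k hk => ?_
    rw [Finset.mem_range] at hj hk
    exact two_mul_le_add_of_convex_of_add_eq h (by omega)
  simp only [Finset.sum_add_distrib, hrefl, Finset.sum_const, Finset.card_range, nsmul_eq_mul,
    Nat.cast_add, Nat.cast_one] at hsum
  linarith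

theorem IsHankelOp.sum_le {α : ℕ → ℝ} {Γ : ℓ2 →L[ℂ] ℓ2} (hΓ : IsHankelOp α Γ) (N : ℕ) :
    ∑ j ∈ Finset.range N, ∑ k ∈ Finset.range N, α (j + k) ≤ ‖Γ‖ * N := by
  set x : ℓ2 := ∑ j ∈ Finset.range N, e j with hx
  have hinner : ⟪Γ x, x⟫ =
      ((∑ j ∈ Finset.range N, ∑ k ∈ Finset.range N, α (j + k) : ℝ) : ℂ) := by
    simp only [hx, map_sum, sum_inner, inner_sum, hΓ _ _, Complex.ofReal_sum]
    exact Finset.sum_comm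
  have hnorm : ‖x‖ * ‖x‖ = N := by
    have h : ⟪x, x⟫ = (N : ℂ) := by
      simp only [hx, sum_inner, inner_sum, inner_e_e]
      simp +contextual
    rw [← inner_self_eq_norm_mul_norm (𝕜 := ℂ) x, h]
    simp
  calc _ ≤ ‖⟪Γ x, x⟫‖ := by
        rw [hinner, Complex.norm_real]; exact le_abs_self _
    _ ≤ ‖Γ x‖ * ‖x‖ := norm_inner_le_norm _ _
    _ ≤ ‖Γ‖ * ‖x‖ * ‖x‖ := by gcongr; exact Γ.le_opNorm x
    _ = ‖Γ‖ * N := by rw [mul_assoc, hnorm]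

theorem IsHankelOp.add_one_mul_abs_le_norm {α : ℕ → ℝ} {Γ ΓS : ℓ2 →L[ℂ] ℓ2}
    (hΓ : IsHankelOp α Γ) (hΓS : IsHankelOp (fun n => α (n + 1)) ΓS)
    (hpos : PosOp Γ) (hposS : PosOp ΓS) (n : ℕ) : ((n : ℝ) + 1) * |α n| ≤ ‖Γ‖ := by
  have hnonneg : 0 ≤ α n := by
    rcases Nat.even_or_odd' n with ⟨k, rfl | rfl⟩ <;> rw [two_mul]
    · exact hpos.nonneg_of_isHankelOp hΓ k
    · exact hposS.nonneg_of_isHankelOp hΓS k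
  have hconvex : ∀ n, 2 * α (n + 1) ≤ α n + α (n + 2) := by
    intro n
    rcases Nat.even_or_odd' n with ⟨k, rfl | rfl⟩ <;> rw [two_mul k]
    · exact hpos.convex_of_isHankelOp hΓ k
    · exact hposS.convex_of_isHankelOp hΓS k
  have h := (sq_mul_le_sum_of_convex hconvex n).trans (hΓ.sum_le (n + 1))
  push_cast at h
  rw [abs_of_nonneg hnonneg]
  have hn : (0 : ℝ) < n + 1 := by positivity
  exact le_of_mul_le_mul_right (by linarith) hn

theorem statement2 (α : ℕ → ℝ) (Γ ΓS : ℓ2 →L[ℂ] ℓ2)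
    (hΓ : IsHankelOp α Γ) (hΓS : IsHankelOp (fun n => α (n + 1)) ΓS)
    (hpos : PosOp Γ) (hposS : PosOp ΓS) :
    (1 / 2 : ℝ≥0∞) * (⨆ n : ℕ, (n + 1 : ℝ≥0∞) * ENNReal.ofReal |α n|) ≤
      ENNReal.ofReal ‖Γ‖ := by
  calc _ ≤ 1 * (⨆ n : ℕ, (n + 1 : ℝ≥0∞) * ENNReal.ofReal |α n|) := by
        gcongr
        simp
    _ ≤ ENNReal.ofReal ‖Γ‖ := by
      rw [one_mul]
      refine iSup_le fun n => ?_
      have hn : (n + 1 : ℝ≥0∞) = ENNReal.ofReal ((n : ℝ) + 1) := by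
        rw [ENNReal.ofReal_add (by positivity) zero_le_one]
        simp
      rw [hn, ← ENNReal.ofReal_mul (by positivity)]
      exact ENNReal.ofReal_le_ofReal (hΓ.add_one_mul_abs_le_norm hΓS hpos hposS n)
end
end

section
/- Let α, β ∈ ℓ^{1,∞}_{++}. If ⟨(Γ_α² − zI)^{-1} e₀, e₀⟩ = ⟨(Γ_β² − zI)^{-1} e₀, e₀⟩ for every z ∈ ℂ with Im z ≠ 0, then α = β (i.e., α_n = β_n for all n ≥ 0). -/
open scoped ComplexInnerProductSpace ComplexOrder ENNReal NNReal
open MeasureTheory Filter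

noncomputable section

lemma nonneg_iff_inner_nonneg {H : Type*} [NormedAddCommGroup H]
    [InnerProductSpace ℂ H] {A : H →L[ℂ] H} : 0 ≤ A ↔ ∀ x, 0 ≤ ⟪A x, x⟫ := by
  rw [ContinuousLinearMap.nonneg_iff_isPositive, ContinuousLinearMap.isPositive_iff_complex]
  refine forall_congr' fun x => ?_
  rw [Complex.nonneg_iff, Complex.ext_iff]
  simp [and_comm]

section InvariantSubspaces

variable {H : Type*} [NormedAddCommGroup H] [InnerProductSpace ℂ H] [CompleteSpace H]

/-- A closed subspace invariant under the square of a positive operator is invariant under the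
operator itself. -/
lemma map_mem_of_sq_map_mem {E : H →L[ℂ] H} (hE : 0 ≤ E) (G : Submodule ℂ H)
    [G.HasOrthogonalProjection] (h : ∀ x ∈ G, E (E x) ∈ G) {x : H} (hx : x ∈ G) : E x ∈ G := by
  have hEs : IsSelfAdjoint E := IsSelfAdjoint.of_nonneg hE
  have hP : IsSelfAdjoint G.starProjection := isSelfAdjoint_starProjection G
  have h1 : G.starProjection * ((E * E) * G.starProjection) = (E * E) * G.starProjection := by
    ext y
    exact Submodule.starProjection_eq_self_iff.2 (h _ (G.starProjection_apply_mem y))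
  have h2 := congrArg star h1
  simp only [star_mul, hEs.star_eq, hP.star_eq] at h2
  have hc : Commute (E * E) G.starProjection := by
    rw [Commute, SemiconjBy, ← h1, ← h2, mul_assoc, ← mul_assoc E]
    simp only [mul_assoc]
  have hc2 : Commute E G.starProjection := by
    have := hc.cfcₙ_nnreal NNReal.sqrt
    rwa [← CFC.sqrt, CFC.sqrt_mul_self E hE] at this
  rw [← Submodule.starProjection_eq_self_iff]
  have h3 := congrArg (fun T : H →L[ℂ] H => T x) hc2.eq
  simp only [mul_apply_eq_comp, Submodule.starProjection_eq_self_iff.2 hx] at h3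
  exact h3.symm

/-- If `T * D = E` with `D`, `E` self-adjoint and leaving the subspace `G` invariant, then `T`
leaves the closure of `D G` invariant. -/
lemma map_mem_closure_map {D E T : H →L[ℂ] H} (hD : IsSelfAdjoint D) (hE : IsSelfAdjoint E)
    (hT : T * D = E) (G : Submodule ℂ H) (hG : IsClosed (G : Set H))
    (hDG : ∀ x ∈ G, D x ∈ G) (hEG : ∀ x ∈ G, E x ∈ G) {y : H}
    (hy : y ∈ (G.map (D : H →ₗ[ℂ] H)).topologicalClosure) :
    T y ∈ (G.map (D : H →ₗ[ℂ] H)).topologicalClosure := by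
  set M := (G.map (D : H →ₗ[ℂ] H)).topologicalClosure with hM
  have hMc : IsClosed (M : Set H) := Submodule.isClosed_topologicalClosure _
  have : CompleteSpace M := hMc.completeSpace_coe
  have hMG : M ≤ G := Submodule.topologicalClosure_minimal _
    (by rintro _ ⟨x, hx, rfl⟩; exact hDG x hx) hG
  have hDM : ∀ x ∈ G, D x ∈ M := fun x hx =>
    Submodule.le_topologicalClosure _ ⟨x, hx, rfl⟩
  have hEM : ∀ x ∈ G, E x ∈ M := by
    intro x hx
    set w := E x - M.starProjection (E x) with hw
    have hwG : w ∈ G := G.sub_mem (hEG x hx) (hMG (M.starProjection_apply_mem _))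
    have hwM : w ∈ Mᗮ := M.sub_starProjection_mem_orthogonal (E x)
    have hDw : D w = 0 := by
      have h1 : ⟪D (D w), w⟫ = 0 := Submodule.inner_right_of_mem_orthogonal (hDM _ (hDG _ hwG)) hwM
      rw [hD.isSymmetric.apply_clm] at h1
      exact inner_self_eq_zero.1 h1
    have hEw : E w = 0 := by rw [← hT, mul_apply_eq_comp, hDw, map_zero]
    have hww : ⟪w, w⟫ = 0 := by
      have h1 : ⟪M.starProjection (E x), w⟫ = 0 :=
        Submodule.inner_right_of_mem_orthogonal (M.starProjection_apply_mem _) hwM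
      have h2 : ⟪E x, w⟫ = 0 := by
        rw [hE.isSymmetric.apply_clm, hEw, inner_zero_right]
      conv_lhs => rw [hw]
      rw [inner_sub_left, ← hw, h1, h2, sub_zero]
    have : E x = M.starProjection (E x) := sub_eq_zero.1 (inner_self_eq_zero.1 hww)
    rw [this]
    exact M.starProjection_apply_mem _
  have hsub : M ≤ M.comap (T : H →ₗ[ℂ] H) := by
    refine Submodule.topologicalClosure_minimal _ ?_ (hMc.preimage T.continuous)
    rintro _ ⟨x, hx, rfl⟩
    have : T (D x) = E x := by rw [← hT, mul_apply_eq_comp]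
    change T (D x) ∈ M
    rw [this]
    exact hEM x hx
  exact hsub hy

end InvariantSubspaces

section Moments

variable {H : Type*} [NormedAddCommGroup H] [InnerProductSpace ℂ H]

lemma inverse_one_sub_smul {T : H →L[ℂ] H} {w : ℂ} (hw : w ≠ 0)
    (hu : IsUnit (T - w⁻¹ • (1 : H →L[ℂ] H))) :
    Ring.inverse (1 - w • T) = (-w⁻¹) • Ring.inverse (T - w⁻¹ • (1 : H →L[ℂ] H)) := by
  have h1 : 1 - w • T = (-w) • (T - w⁻¹ • (1 : H →L[ℂ] H)) := by
    rw [smul_sub, smul_smul, neg_mul, mul_inv_cancel₀ hw, neg_smul, neg_smul, one_smul]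
    abel
  rw [h1]
  have h2 : (-w) • (T - w⁻¹ • (1 : H →L[ℂ] H)) *
      ((-w⁻¹) • Ring.inverse (T - w⁻¹ • (1 : H →L[ℂ] H))) = 1 := by
    rw [smul_mul_smul_comm, Ring.mul_inverse_cancel _ hu, neg_mul_neg, mul_inv_cancel₀ hw, one_smul]
  have h3 : IsUnit ((-w) • (T - w⁻¹ • (1 : H →L[ℂ] H))) :=
    hu.smul (Units.mk0 (-w) (neg_ne_zero.2 hw))
  simpa only [mul_one] using (Ring.inverse_mul_eq_iff_eq_mul _ 1 _ h3).2 h2.symm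

variable [CompleteSpace H]

lemma hasFPowerSeriesAt_inner_inverse_one_sub_smul (T : H →L[ℂ] H) (v : H) :
    HasFPowerSeriesAt (fun w : ℂ => ⟪v, (Ring.inverse (1 - w • T) : H →L[ℂ] H) v⟫)
      (fun n => ContinuousMultilinearMap.mkPiRing ℂ (Fin n) ⟪v, (T ^ n) v⟫) 0 := by
  let φ : (H →L[ℂ] H) →L[ℂ] ℂ := (innerSL ℂ v).comp (ContinuousLinearMap.apply ℂ H v)
  have h1 := φ.comp_hasFPowerSeriesOnBall
    (spectrum.hasFPowerSeriesOnBall_inverse_one_sub_smul ℂ T)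
  have h2 : φ.compFormalMultilinearSeries
      (fun n => ContinuousMultilinearMap.mkPiRing ℂ (Fin n) (T ^ n)) =
      fun n => ContinuousMultilinearMap.mkPiRing ℂ (Fin n) ⟪v, (T ^ n) v⟫ := by
    funext n
    refine ContinuousMultilinearMap.ext fun m => ?_
    change φ ((∏ i, m i) • T ^ n) = (∏ i, m i) • ⟪v, (T ^ n) v⟫
    rw [map_smul]
    rfl
  rw [h2] at h1
  exact h1.hasFPowerSeriesAt

/-- The resolvent matrix elements at a vector determine the moments at that vector. -/
lemma inner_pow_eq_of_resolvent_eq {T T' : H →L[ℂ] H} {v : H}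
    (hT : ∀ z : ℂ, z.im ≠ 0 → IsUnit (T - z • (1 : H →L[ℂ] H)))
    (hT' : ∀ z : ℂ, z.im ≠ 0 → IsUnit (T' - z • (1 : H →L[ℂ] H)))
    (h : ∀ z : ℂ, z.im ≠ 0 → ⟪v, (Ring.inverse (T - z • 1) : H →L[ℂ] H) v⟫ =
      ⟪v, (Ring.inverse (T' - z • 1) : H →L[ℂ] H) v⟫) (n : ℕ) :
    ⟪v, (T ^ n) v⟫ = ⟪v, (T' ^ n) v⟫ := by
  have h1 := hasFPowerSeriesAt_inner_inverse_one_sub_smul T v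
  have h2 := hasFPowerSeriesAt_inner_inverse_one_sub_smul T' v
  have heq : ∀ w : ℂ, w.im ≠ 0 → ⟪v, (Ring.inverse (1 - w • T) : H →L[ℂ] H) v⟫ =
      ⟪v, (Ring.inverse (1 - w • T') : H →L[ℂ] H) v⟫ := by
    intro w hw
    have hw0 : w ≠ 0 := by rintro rfl; simp at hw
    have hwi : (w⁻¹).im ≠ 0 := by
      rw [Complex.inv_im]
      exact div_ne_zero (neg_ne_zero.2 hw) (Complex.normSq_pos.2 hw0).ne'
    rw [inverse_one_sub_smul hw0 (hT _ hwi), inverse_one_sub_smul hw0 (hT' _ hwi)]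
    simp only [smul_apply, inner_smul_right, h _ hwi]
  have hfreq : ∃ᶠ w in nhdsWithin (0 : ℂ) {0}ᶜ,
      ⟪v, (Ring.inverse (1 - w • T) : H →L[ℂ] H) v⟫ =
      ⟪v, (Ring.inverse (1 - w • T') : H →L[ℂ] H) v⟫ := by
    have ht : Tendsto (fun t : ℝ => (t : ℂ) * Complex.I) (nhdsWithin 0 {0}ᶜ)
        (nhdsWithin (0 : ℂ) {0}ᶜ) := by
      refine tendsto_nhdsWithin_iff.2 ⟨?_, ?_⟩
      · have : Continuous (fun t : ℝ => (t : ℂ) * Complex.I) := by fun_prop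
        simpa using (this.tendsto 0).mono_left nhdsWithin_le_nhds
      · filter_upwards [self_mem_nhdsWithin] with t ht
        simpa using ht
    refine ht.frequently (Eventually.frequently ?_)
    filter_upwards [self_mem_nhdsWithin] with t ht
    exact heq _ (by simpa using ht)
  have hev := (h1.analyticAt.frequently_eq_iff_eventually_eq h2.analyticAt).1 hfreq
  have hp := h1.eq_formalMultilinearSeries_of_eventually h2 hev
  have := congrArg (fun p : FormalMultilinearSeries ℂ ℂ ℂ => p n (fun _ => 1)) hp
  simpa using this

end Moments

section Product

variable {H : Type*} [NormedAddCommGroup H] [InnerProductSpace ℂ H]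

/-- The diagonal operator `A ⊕ B` on the Hilbert sum `H ⊕ H`. -/
def diagOp (A B : H →L[ℂ] H) : WithLp 2 (H × H) →L[ℂ] WithLp 2 (H × H) :=
  ((WithLp.prodContinuousLinearEquiv 2 ℂ H H).symm : H × H →L[ℂ] WithLp 2 (H × H)) ∘L
    (A.prodMap B) ∘L (WithLp.prodContinuousLinearEquiv 2 ℂ H H : WithLp 2 (H × H) →L[ℂ] H × H)

lemma diagOp_nonneg {A B : H →L[ℂ] H} (hA : 0 ≤ A) (hB : 0 ≤ B) : 0 ≤ diagOp A B := by
  rw [nonneg_iff_inner_nonneg] at *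
  intro x
  rw [WithLp.prod_inner_apply]
  exact add_nonneg (hA _) (hB _)

variable [CompleteSpace H]

/-- Uniqueness for the inverse problem: `A` positive, `T A = B` positive with
`B² = A² - ⟪·, A v⟫ A v`; then the moments of `A²` at `v` determine all `⟪v, T ^ n (A v)⟫`. -/
lemma inner_pow_apply_eq_of_moments_eq {A B T A' B' T' : H →L[ℂ] H} {v : H}
    (hA : 0 ≤ A) (hB : 0 ≤ B) (hA' : 0 ≤ A') (hB' : 0 ≤ B') (hT : T * A = B) (hT' : T' * A' = B')
    (hsq : ∀ x, B (B x) = A (A x) - ⟪A v, x⟫ • A v)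
    (hsq' : ∀ x, B' (B' x) = A' (A' x) - ⟪A' v, x⟫ • A' v)
    (hm : ∀ n, ⟪v, ((A ^ 2) ^ n) v⟫ = ⟪v, ((A' ^ 2) ^ n) v⟫) (n : ℕ) :
    ⟪v, (T ^ n) (A v)⟫ = ⟪v, (T' ^ n) (A' v)⟫ := by
  let K := WithLp 2 (H × H)
  have hD := diagOp_nonneg hA hA'
  have hE := diagOp_nonneg hB hB'
  set D := diagOp A A' with hDdef
  set E := diagOp B B' with hEdef
  let u : ℕ → K := fun n => WithLp.toLp 2 (((A ^ 2) ^ n) v, ((A' ^ 2) ^ n) v)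
  let G : Submodule ℂ K := (Submodule.span ℂ (Set.range u)).topologicalClosure
  have hGc : IsClosed (G : Set K) := Submodule.isClosed_topologicalClosure _
  have : CompleteSpace G := hGc.completeSpace_coe
  have huG : ∀ n, u n ∈ G := fun n =>
    Submodule.le_topologicalClosure _ (Submodule.subset_span ⟨n, rfl⟩)
  have hmin : ∀ M : Submodule ℂ K, IsClosed (M : Set K) → (∀ n, u n ∈ M) → G ≤ M := by
    intro M hM hu
    refine Submodule.topologicalClosure_minimal _ (Submodule.span_le.2 ?_) hM
    rintro _ ⟨n, rfl⟩
    exact hu n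
  have hDDG : ∀ x ∈ G, D (D x) ∈ G := by
    refine hmin (G.comap ((D * D : K →L[ℂ] K) : K →ₗ[ℂ] K))
      (hGc.preimage (D * D : K →L[ℂ] K).continuous) fun n => ?_
    have : D (D (u n)) = u (n + 1) := by
      refine WithLp.ofLp_injective 2 (Prod.ext ?_ ?_)
      · change A (A (((A ^ 2) ^ n) v)) = ((A ^ 2) ^ (n + 1)) v
        rw [pow_succ' (A ^ 2), sq]; rfl
      · change A' (A' (((A' ^ 2) ^ n) v)) = ((A' ^ 2) ^ (n + 1)) v
        rw [pow_succ' (A' ^ 2), sq]; rfl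
    change D (D (u n)) ∈ G
    rw [this]
    exact huG _
  have hDG : ∀ x ∈ G, D x ∈ G := fun x hx => map_mem_of_sq_map_mem hD G hDDG hx
  have hpow : ∀ {C : H →L[ℂ] H}, 0 ≤ C → ∀ m k, ⟪((C ^ 2) ^ m) v, ((C ^ 2) ^ k) v⟫ =
      ⟪v, ((C ^ 2) ^ (m + k)) v⟫ := by
    intro C hC m k
    have : IsSelfAdjoint ((C ^ 2) ^ m) := ((IsSelfAdjoint.of_nonneg hC).pow 2).pow m
    rw [this.isSymmetric.apply_clm, pow_add, mul_apply_eq_comp]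
  have hiso : ∀ x ∈ G, ∀ y ∈ G, ⟪x.fst, y.fst⟫ = ⟪x.snd, y.snd⟫ := by
    let J : K →L[ℂ] K := diagOp 1 (-1)
    have hJ : ∀ x y : K, ⟪x, J y⟫ = 0 ↔ ⟪x.fst, y.fst⟫ = ⟪x.snd, y.snd⟫ := by
      intro x y
      rw [WithLp.prod_inner_apply]
      change ⟪x.fst, y.fst⟫ + ⟪x.snd, -y.snd⟫ = 0 ↔ _
      rw [inner_neg_right, ← sub_eq_add_neg, sub_eq_zero]
    have h1 : ∀ m, ∀ y ∈ G, ⟪u m, J y⟫ = 0 := by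
      intro m
      refine hmin (LinearMap.ker (((innerSL ℂ (u m)).comp J : K →L[ℂ] ℂ) : K →ₗ[ℂ] ℂ))
        (ContinuousLinearMap.isClosed_ker _) fun k => ?_
      change ⟪u m, J (u k)⟫ = 0
      rw [hJ]
      change ⟪((A ^ 2) ^ m) v, ((A ^ 2) ^ k) v⟫ = ⟪((A' ^ 2) ^ m) v, ((A' ^ 2) ^ k) v⟫
      rw [hpow hA, hpow hA', hm]
    intro x hx y hy
    rw [← hJ, ← inner_conj_symm]
    have h2 : x ∈ LinearMap.ker ((innerSL ℂ (J y) : K →L[ℂ] ℂ) : K →ₗ[ℂ] ℂ) := by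
      refine hmin _ (ContinuousLinearMap.isClosed_ker _) (fun m => ?_) hx
      change ⟪J y, u m⟫ = 0
      rw [← inner_conj_symm, h1 m y hy, map_zero]
    have h3 : ⟪J y, x⟫ = 0 := h2
    rw [h3, map_zero]
  have hv : u 0 ∈ G := huG 0
  have hDv : D (u 0) ∈ G := hDG _ hv
  have hEEG : ∀ x ∈ G, E (E x) ∈ G := by
    intro x hx
    have hi : ⟪A v, x.fst⟫ = ⟪A' v, x.snd⟫ := hiso _ hDv x hx
    have : E (E x) = D (D x) - ⟪A v, x.fst⟫ • D (u 0) := by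
      refine WithLp.ofLp_injective 2 (Prod.ext ?_ ?_)
      · exact hsq x.fst
      · rw [hi]; exact hsq' x.snd
    rw [this]
    exact G.sub_mem (hDDG x hx) (G.smul_mem _ hDv)
  have hEG : ∀ x ∈ G, E x ∈ G := fun x hx => map_mem_of_sq_map_mem hE G hEEG hx
  have hS : diagOp T T' * D = E := by
    refine ContinuousLinearMap.ext fun x => WithLp.ofLp_injective 2 (Prod.ext ?_ ?_)
    · exact congrArg (fun C : H →L[ℂ] H => C x.fst) hT
    · exact congrArg (fun C : H →L[ℂ] H => C x.snd) hT'
  set M := (G.map (D : K →ₗ[ℂ] K)).topologicalClosure with hM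
  have hMG : M ≤ G := Submodule.topologicalClosure_minimal _
    (by rintro _ ⟨x, hx, rfl⟩; exact hDG x hx) hGc
  have hmem : ∀ n, WithLp.toLp 2 ((T ^ n) (A v), (T' ^ n) (A' v)) ∈ M := by
    intro n
    induction n with
    | zero => exact Submodule.le_topologicalClosure _ ⟨u 0, hv, rfl⟩
    | succ n ih =>
      have := map_mem_closure_map (IsSelfAdjoint.of_nonneg hD) (IsSelfAdjoint.of_nonneg hE) hS G
        hGc hDG hEG ih
      rw [pow_succ', pow_succ']
      exact this
  exact hiso _ hv _ (hMG (hmem n))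

end Product

section Shift

lemma inner_e_left (n : ℕ) (x : ℓ2) : ⟪e n, x⟫ = x n := by
  simp [e, lp.inner_single_left]

lemma ext_inner_e {x y : ℓ2} (h : ∀ n, ⟪e n, x⟫ = ⟪e n, y⟫) : x = y := by
  refine lp.ext (funext fun n => ?_)
  simpa only [inner_e_left] using h n

lemma clm_ext_inner_e {A B : ℓ2 →L[ℂ] ℓ2} (h : ∀ n m, ⟪A (e n), e m⟫ = ⟪B (e n), e m⟫) :
    A = B := by
  refine ContinuousLinearMap.ext fun x => ext_inner_e fun m => ?_
  rw [← ContinuousLinearMap.adjoint_inner_left, ← ContinuousLinearMap.adjoint_inner_left]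
  congr 1
  refine ext_inner_e fun n => ?_
  rw [ContinuousLinearMap.adjoint_inner_right, ContinuousLinearMap.adjoint_inner_right, h]

lemma orthonormal_e : Orthonormal ℂ e := by
  rw [orthonormal_iff_ite]
  intro i j
  rw [inner_e_left, e, lp.single_apply, Pi.single_apply]

lemma orthonormal_e_succ : Orthonormal ℂ (fun n => e (n + 1)) :=
  orthonormal_e.comp _ (add_left_injective 1)

/-- The right shift on `ℓ²`. -/
def rightShift : ℓ2 →L[ℂ] ℓ2 :=
  orthonormal_e_succ.orthogonalFamily.linearIsometry.toContinuousLinearMap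

lemma rightShift_e (n : ℕ) : rightShift (e n) = e (n + 1) := by
  simp [rightShift, e]

/-- The left shift on `ℓ²`. -/
def leftShift : ℓ2 →L[ℂ] ℓ2 := ContinuousLinearMap.adjoint rightShift

lemma inner_e_leftShift (n : ℕ) (x : ℓ2) : ⟪e n, leftShift x⟫ = ⟪e (n + 1), x⟫ := by
  rw [leftShift, ContinuousLinearMap.adjoint_inner_right, rightShift_e]

lemma inner_e_leftShift_pow (n : ℕ) (x : ℓ2) : ⟪e 0, (leftShift ^ n) x⟫ = ⟪e n, x⟫ := by
  induction n generalizing x with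
  | zero => simp
  | succ n ih => rw [pow_succ, mul_apply_eq_comp, ih, inner_e_leftShift]

lemma rightShift_leftShift (x : ℓ2) : rightShift (leftShift x) = x - ⟪e 0, x⟫ • e 0 := by
  refine ext_inner_e fun n => ?_
  rw [← ContinuousLinearMap.adjoint_inner_left, ← leftShift, inner_sub_right, inner_smul_right,
    orthonormal_iff_ite.1 orthonormal_e]
  cases n with
  | zero =>
    have : leftShift (e 0) = 0 := ext_inner_e fun m => by
      rw [inner_e_leftShift, orthonormal_iff_ite.1 orthonormal_e, inner_zero_right]; simp
    simp [this]
  | succ n =>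
    have : leftShift (e (n + 1)) = e n := ext_inner_e fun m => by
      rw [inner_e_leftShift, orthonormal_iff_ite.1 orthonormal_e,
        orthonormal_iff_ite.1 orthonormal_e]; simp
    rw [this, inner_e_leftShift]; simp

variable {α : ℕ → ℝ} {Γ ΓS : ℓ2 →L[ℂ] ℓ2}

lemma leftShift_mul_hankel (h : IsHankelOp α Γ) (hS : IsHankelOp (fun n => α (n + 1)) ΓS) :
    leftShift * Γ = ΓS := by
  refine clm_ext_inner_e fun n m => ?_
  rw [hS, mul_apply_eq_comp, leftShift, ContinuousLinearMap.adjoint_inner_left,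
    rightShift_e, h, ← add_assoc]

lemma shifted_hankel_sq (h : IsHankelOp α Γ) (hS : IsHankelOp (fun n => α (n + 1)) ΓS)
    (hΓ : 0 ≤ Γ) (hΓS : 0 ≤ ΓS) (x : ℓ2) :
    ΓS (ΓS x) = Γ (Γ x) - ⟪Γ (e 0), x⟫ • Γ (e 0) := by
  have h1 := leftShift_mul_hankel h hS
  have h2 : Γ * rightShift = ΓS := by
    have := congrArg star h1
    rwa [star_mul, (IsSelfAdjoint.of_nonneg hΓ).star_eq, (IsSelfAdjoint.of_nonneg hΓS).star_eq,
      leftShift, ContinuousLinearMap.star_eq_adjoint, ContinuousLinearMap.adjoint_adjoint] at this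
  calc ΓS (ΓS x) = (Γ * rightShift) ((leftShift * Γ) x) := by rw [h1, h2]
    _ = Γ (rightShift (leftShift (Γ x))) := rfl
    _ = _ := by
      rw [rightShift_leftShift, map_sub, map_smul,
        (IsSelfAdjoint.of_nonneg hΓ).isSymmetric.apply_clm (e 0)]

lemma inner_e_leftShift_pow_hankel (h : IsHankelOp α Γ) (n : ℕ) :
    ⟪e 0, (leftShift ^ n) (Γ (e 0))⟫ = (α n : ℂ) := by
  rw [inner_e_leftShift_pow, ← inner_conj_symm, h]
  simp

end Shift

theorem statement12 (α β : ℕ → ℝ) (Γα ΓαS Γβ ΓβS : ℓ2 →L[ℂ] ℓ2)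
    (hα : MemL1infPP α Γα ΓαS) (hβ : MemL1infPP β Γβ ΓβS)
    (hinvα : ∀ z : ℂ, z.im ≠ 0 → IsUnit (Γα ^ 2 - z • (1 : ℓ2 →L[ℂ] ℓ2)))
    (hinvβ : ∀ z : ℂ, z.im ≠ 0 → IsUnit (Γβ ^ 2 - z • (1 : ℓ2 →L[ℂ] ℓ2)))
    (h : ∀ z : ℂ, z.im ≠ 0 →
      ⟪e 0, (Ring.inverse (Γα ^ 2 - z • 1) : ℓ2 →L[ℂ] ℓ2) (e 0)⟫ =
      ⟪e 0, (Ring.inverse (Γβ ^ 2 - z • 1) : ℓ2 →L[ℂ] ℓ2) (e 0)⟫) :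
    α = β := by
  obtain ⟨-, hα1, hα2, hα3, hα4⟩ := hα
  obtain ⟨-, hβ1, hβ2, hβ3, hβ4⟩ := hβ
  have hα3' := nonneg_iff_inner_nonneg.2 hα3
  have hα4' := nonneg_iff_inner_nonneg.2 hα4
  have hβ3' := nonneg_iff_inner_nonneg.2 hβ3
  have hβ4' := nonneg_iff_inner_nonneg.2 hβ4
  funext n
  have key := inner_pow_apply_eq_of_moments_eq hα3' hα4' hβ3' hβ4'
    (leftShift_mul_hankel hα1 hα2) (leftShift_mul_hankel hβ1 hβ2)
    (shifted_hankel_sq hα1 hα2 hα3' hα4') (shifted_hankel_sq hβ1 hβ2 hβ3' hβ4')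
    (inner_pow_eq_of_resolvent_eq hinvα hinvβ h) n
  rw [inner_e_leftShift_pow_hankel hα1, inner_e_leftShift_pow_hankel hβ1] at key
  exact_mod_cast key
end
end

section
/- Let R > 0 and let (α^{(p)})_{p≥1} be a sequence of elements of ℓ^{1,∞}_{++} with sup_{n≥0}(n+1)|α^{(p)}_n| ≤ R for all p. Let α be a real sequence such that α^{(p)}_n → α_n as p → ∞ for every n ≥ 0. Then: α ∈ ℓ^{1,∞}_{++}; Γ_{α^{(p)}} → Γ_α and Γ_{S*α^{(p)}} → Γ_{S*α} in the strong operator topology as p → ∞; and for every z ∈ ℂ with Im z ≠ 0, ⟨(Γ_{α^{(p)}}² − zI)^{-1} e₀, e₀⟩ → ⟨(Γ_α² − zI)^{-1} e₀, e₀⟩ as p → ∞. -/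
open scoped ComplexInnerProductSpace ComplexOrder ENNReal NNReal
open MeasureTheory Filter

noncomputable section

theorem sum_inv_sqrt_mul_le (n N : ℕ) :
    ∑ m ∈ Finset.range N, 1 / (√(m + 1) * (n + m + 1)) ≤ 8 / √(n + 1) := by
  have hr : 0 < √((n : ℝ) + 1) := by positivity
  have step (m : ℕ) : 1 / (√((m : ℝ) + 1) * (n + m + 1)) ≤
      8 / √((n : ℝ) + 1) * (√((m + 1 : ℕ) : ℝ) / (√((m + 1 : ℕ) : ℝ) + √((n : ℝ) + 1)))
        - 8 / √((n : ℝ) + 1) * (√(m : ℝ) / (√(m : ℝ) + √((n : ℝ) + 1))) := by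
    push_cast
    have hs := Real.sq_sqrt (Nat.cast_nonneg (α := ℝ) m)
    have ht := Real.sq_sqrt (show (0 : ℝ) ≤ m + 1 by positivity)
    have hr2 := Real.sq_sqrt (show (0 : ℝ) ≤ n + 1 by positivity)
    have ht0 : 0 < √((m : ℝ) + 1) := by positivity
    have hst : √(m : ℝ) ≤ √((m : ℝ) + 1) := Real.sqrt_le_sqrt (by linarith)
    have hs0 := Real.sqrt_nonneg (m : ℝ)
    have hn0 := Nat.cast_nonneg (α := ℝ) n
    have hm0 := Nat.cast_nonneg (α := ℝ) m
    set s := √(m : ℝ)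
    set t := √((m : ℝ) + 1)
    set r := √((n : ℝ) + 1)
    have hdiff : (t - s) * (t + s) = 1 := by nlinarith
    have h1 : 8 / r * (t / (t + r)) - 8 / r * (s / (s + r)) =
        8 / ((t + s) * ((t + r) * (s + r))) := by
      field_simp
      linear_combination 1 * r * hdiff
    rw [h1, div_le_div_iff₀ (by positivity) (by positivity)]
    have h2 : (t + r) * (s + r) ≤ 4 * (n + m + 1) := by
      nlinarith [sq_nonneg (t - r), mul_le_mul_of_nonneg_left hst (show 0 ≤ t + r by positivity)]
    calc 1 * ((t + s) * ((t + r) * (s + r))) ≤ (2 * t) * (4 * (n + m + 1)) := by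
          rw [one_mul]; gcongr; linarith
      _ = 8 * (t * (n + m + 1)) := by ring
  refine (Finset.sum_le_sum fun m _ => step m).trans ?_
  rw [Finset.sum_range_sub
    (fun m : ℕ => 8 / √((n : ℝ) + 1) * (√(m : ℝ) / (√(m : ℝ) + √((n : ℝ) + 1))))]
  have : √(N : ℝ) / (√(N : ℝ) + √((n : ℝ) + 1)) ≤ 1 :=
    div_le_one_of_le₀ (by linarith) (by positivity)
  simp only [Nat.cast_zero, Real.sqrt_zero, zero_div, mul_zero, sub_zero]
  exact mul_le_of_le_one_right (by positivity) this

/-- A discrete Hilbert inequality, by the Schur test with weights `1 / √(n + 1)`. -/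
theorem hilbert_inequality (u v : ℕ → ℝ) (N : ℕ) :
    ∑ n ∈ Finset.range N, ∑ m ∈ Finset.range N, u n * v m / (n + m + 1) ≤
      4 * (∑ n ∈ Finset.range N, u n ^ 2 + ∑ m ∈ Finset.range N, v m ^ 2) := by
  have weighted (w : ℕ → ℝ) : ∑ n ∈ Finset.range N, ∑ m ∈ Finset.range N,
      w n ^ 2 * √(n + 1) / 2 * (1 / (√(m + 1) * (n + m + 1))) ≤
        4 * ∑ n ∈ Finset.range N, w n ^ 2 := by
    rw [Finset.mul_sum]
    refine Finset.sum_le_sum fun n _ => ?_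
    rw [← Finset.mul_sum]
    calc _ ≤ w n ^ 2 * √(n + 1) / 2 * (8 / √(n + 1)) := by
          gcongr; exact sum_inv_sqrt_mul_le n N
      _ = 4 * w n ^ 2 := by field_simp; ring
  have hv := weighted v
  rw [Finset.sum_comm] at hv
  rw [mul_add]
  refine le_trans ?_ (add_le_add (weighted u) hv)
  rw [← Finset.sum_add_distrib]
  refine Finset.sum_le_sum fun n _ => ?_
  rw [← Finset.sum_add_distrib]
  refine Finset.sum_le_sum fun m _ => ?_
  have hs : 0 < √((n : ℝ) + 1) := by positivity
  have ht : 0 < √((m : ℝ) + 1) := by positivity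
  set s := √((n : ℝ) + 1)
  set t := √((m : ℝ) + 1)
  have : u n ^ 2 * s / 2 * (1 / (t * (n + m + 1))) + v m ^ 2 * t / 2 * (1 / (s * (m + n + 1)))
      - u n * v m / (n + m + 1) = (u n * s - v m * t) ^ 2 / (2 * s * t * (n + m + 1)) := by
    rw [show (m : ℝ) + n + 1 = n + m + 1 by ring]
    field_simp
    ring
  rw [← sub_nonneg, this]
  positivity

theorem tendsto_sum_smul_e (x : ℓ2) :
    Tendsto (fun N => ∑ i ∈ Finset.range N, x i • e i) atTop (nhds x) := by
  have h := (lp.hasSum_single (p := 2) (by simp) x).tendsto_sum_nat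
  refine h.congr fun N => Finset.sum_congr rfl fun i _ => ?_
  rw [e, ← lp.single_smul, smul_eq_mul, mul_one]

theorem hasSum_norm_sq (x : ℓ2) : HasSum (fun i => ‖x i‖ ^ 2) (‖x‖ ^ 2) := by
  simpa using lp.hasSum_norm (p := 2) (by simp) x

theorem IsHankelOp.apply_e {α : ℕ → ℝ} {Γ : ℓ2 →L[ℂ] ℓ2} (h : IsHankelOp α Γ) (n m : ℕ) :
    Γ (e n) m = α (n + m) := by
  have := h n m
  rw [e, e, lp.inner_single_right] at this
  have h2 := congrArg (starRingEnd ℂ) this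
  simpa [e] using h2

theorem IsHankelOp.norm_le {α : ℕ → ℝ} {Γ : ℓ2 →L[ℂ] ℓ2} (h : IsHankelOp α Γ) {R : ℝ}
    (hR : ∀ n : ℕ, (n + 1 : ℝ) * |α n| ≤ R) : ‖Γ‖ ≤ 8 * R := by
  have hR0 : 0 ≤ R := le_trans (by positivity) (hR 0)
  refine ContinuousLinearMap.opNorm_le_of_re_inner_le (by positivity) fun x y hx hy => ?_
  have hx' := tendsto_sum_smul_e x
  have hy' := tendsto_sum_smul_e y
  have hlim := ((Γ.continuous.tendsto x).comp hx').inner (𝕜 := ℂ) hy'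
  refine le_of_tendsto ((Complex.continuous_re.tendsto _).comp hlim) (.of_forall fun N => ?_)
  have hsum (z : ℓ2) (hz : ‖z‖ = 1) : ∑ i ∈ Finset.range N, ‖z i‖ ^ 2 ≤ 1 := by
    have := sum_le_hasSum (Finset.range N) (fun i _ => by positivity) (hasSum_norm_sq z)
    simpa [hz] using this
  refine (Complex.re_le_norm _).trans ?_
  simp only [Function.comp_apply, map_sum, map_smul, sum_inner]
  simp only [inner_sum]
  simp only [inner_smul_left, inner_smul_right, h _ _]
  have hterm (n m : ℕ) : ‖y m * (starRingEnd ℂ (x n) * (α (n + m) : ℂ))‖ ≤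
      R * (‖x n‖ * ‖y m‖ / (n + m + 1)) := by
    have hα := hR (n + m)
    push_cast at hα
    have hα' : |α (n + m)| ≤ R / (n + m + 1) := by
      rw [le_div_iff₀ (by positivity)]; linarith
    simp only [norm_mul, RCLike.norm_conj, Complex.norm_real, Real.norm_eq_abs]
    calc _ = ‖x n‖ * ‖y m‖ * |α (n + m)| := by ring
      _ ≤ ‖x n‖ * ‖y m‖ * (R / (n + m + 1)) := by gcongr
      _ = _ := by ring
  refine le_trans (b := ∑ n ∈ Finset.range N, ∑ m ∈ Finset.range N,
    R * (‖x n‖ * ‖y m‖ / (n + m + 1))) ?_ ?_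
  · refine norm_sum_le_of_le _ fun n _ => ?_
    refine norm_sum_le_of_le _ fun m _ => ?_
    exact hterm n m
  calc _ ≤ R * (4 * (∑ n ∈ Finset.range N, ‖x n‖ ^ 2 + ∑ m ∈ Finset.range N, ‖y m‖ ^ 2)) := by
        simp only [← Finset.mul_sum]
        gcongr
        exact hilbert_inequality (fun n => ‖x n‖) (fun n => ‖y n‖) N
    _ ≤ R * (4 * (1 + 1)) := by gcongr <;> [exact hsum x hx; exact hsum y hy]
    _ = 8 * R := by ring

theorem summable_div_add_one_sq (C : ℝ) : Summable fun m : ℕ => (C / (m + 1)) ^ 2 := by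
  have h := (summable_nat_add_iff 1).2 (Real.summable_one_div_nat_pow.2 one_lt_two)
  refine (h.mul_left (C ^ 2)).congr fun m => ?_
  push_cast
  field_simp

theorem tendsto_of_forall_norm_le {v : ℕ → ℓ2} {w : ℕ → ℂ} {C : ℝ}
    (hv : ∀ p m, ‖v p m‖ ≤ C / (m + 1)) (hw : ∀ m, Tendsto (fun p => v p m) atTop (nhds (w m))) :
    ∃ y : ℓ2, Tendsto v atTop (nhds y) := by
  have hwb (m : ℕ) : ‖w m‖ ≤ C / (m + 1) := le_of_tendsto' (hw m).norm fun p => hv p m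
  have hmem : Memℓp w 2 := by
    refine memℓp_gen ?_
    simp only [ENNReal.toReal_ofNat, Real.rpow_ofNat]
    exact (summable_div_add_one_sq C).of_nonneg_of_le (fun m => by positivity)
      fun m => by gcongr; exact hwb m
  let y : ℓ2 := ⟨w, hmem⟩
  refine ⟨y, ?_⟩
  rw [tendsto_iff_norm_sub_tendsto_zero]
  have key : Tendsto (fun p => ∑' m, ‖v p m - w m‖ ^ 2) atTop (nhds (∑' _ : ℕ, (0 : ℝ))) := by
    refine tendsto_tsum_of_dominated_convergence (summable_div_add_one_sq (2 * C))
      (fun m => ?_) (.of_forall fun p m => ?_)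
    · simpa using ((hw m).sub_const (w m)).norm.pow 2
    · rw [Real.norm_of_nonneg (by positivity)]
      gcongr
      calc _ ≤ ‖v p m‖ + ‖w m‖ := norm_sub_le _ _
        _ ≤ C / (m + 1) + C / (m + 1) := add_le_add (hv p m) (hwb m)
        _ = _ := by ring
  have h2 : (fun p => ∑' m, ‖v p m - w m‖ ^ 2) = fun p => ‖v p - y‖ ^ 2 :=
    funext fun p => (hasSum_norm_sq (v p - y)).tsum_eq
  rw [h2, tsum_zero] at key
  simpa using key.sqrt

theorem exists_tendsto_of_tendsto_e {T : ℕ → ℓ2 →L[ℂ] ℓ2} {C : ℝ} (hC : ∀ p, ‖T p‖ ≤ C)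
    (he : ∀ n, ∃ y, Tendsto (fun p => T p (e n)) atTop (nhds y)) :
    ∃ S : ℓ2 →L[ℂ] ℓ2, ∀ x, Tendsto (fun p => T p x) atTop (nhds (S x)) := by
  have hx (x : ℓ2) : ∃ y, Tendsto (fun p => T p x) atTop (nhds y) := by
    refine cauchySeq_tendsto_of_complete (Metric.cauchySeq_iff'.2 fun ε hε => ?_)
    have hC0 : 0 ≤ C := (norm_nonneg _).trans (hC 0)
    obtain ⟨N, hN⟩ := ((Metric.tendsto_nhds.1 (tendsto_sum_smul_e x))
      (ε / (4 * (C + 1))) (by positivity)).exists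
    set u := ∑ i ∈ Finset.range N, x i • e i
    choose y hy using he
    have hu : Tendsto (fun p => T p u) atTop (nhds (∑ i ∈ Finset.range N, x i • y i)) := by
      simp only [u, map_sum, map_smul]
      exact tendsto_finsetSum _ fun i _ => (hy i).const_smul (x i)
    obtain ⟨M, hM⟩ := Metric.cauchySeq_iff'.1 hu.cauchySeq (ε / 2) (by positivity)
    have hclose (p : ℕ) : dist (T p x) (T p u) < ε / 4 := by
      rw [dist_comm, dist_eq_norm] at hN
      rw [dist_eq_norm, ← map_sub]
      calc _ ≤ C * ‖x - u‖ := (T p).le_of_opNorm_le (hC p) _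
        _ ≤ (C + 1) * ‖x - u‖ := by gcongr; linarith
        _ < (C + 1) * (ε / (4 * (C + 1))) := by gcongr
        _ = ε / 4 := by field_simp
    refine ⟨M, fun p hp => ?_⟩
    have h1 := hclose p
    have h2 := hclose M
    have h3 := hM p hp
    have h4 := dist_triangle4 (T p x) (T p u) (T M u) (T M x)
    rw [dist_comm (T M u)] at h4
    linarith
  choose f hf using hx
  exact ⟨continuousLinearMapOfTendsto T (f := f) (tendsto_pi_nhds.2 hf), hf⟩

theorem exists_strong_limit_hankel {b : ℕ → ℕ → ℝ} {T : ℕ → ℓ2 →L[ℂ] ℓ2} {β : ℕ → ℝ} {R : ℝ}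
    (hT : ∀ p, IsHankelOp (b p) (T p)) (hpos : ∀ p, PosOp (T p))
    (hbd : ∀ p n : ℕ, (n + 1 : ℝ) * |b p n| ≤ R)
    (hconv : ∀ n, Tendsto (fun p => b p n) atTop (nhds (β n))) :
    ∃ S : ℓ2 →L[ℂ] ℓ2, IsHankelOp β S ∧ PosOp S ∧
      ∀ x, Tendsto (fun p => T p x) atTop (nhds (S x)) := by
  obtain ⟨S, hS⟩ := exists_tendsto_of_tendsto_e (fun p => (hT p).norm_le (hbd p)) fun n => by
    refine tendsto_of_forall_norm_le (C := R) (w := fun m => (β (n + m) : ℂ)) (fun p m => ?_)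
      fun m => ?_
    · rw [(hT p).apply_e, Complex.norm_real, Real.norm_eq_abs, le_div_iff₀ (by positivity),
        mul_comm]
      refine le_trans ?_ (hbd p (n + m))
      push_cast
      gcongr
      linarith [Nat.cast_nonneg (α := ℝ) n]
    · simp only [(hT _).apply_e]
      exact (Complex.continuous_ofReal.tendsto _).comp (hconv _)
  refine ⟨S, fun n m => ?_, fun x => ?_, hS⟩
  · refine tendsto_nhds_unique ((hS (e n)).inner (𝕜 := ℂ) tendsto_const_nhds) ?_
    simp only [hT _ n m]
    exact (Complex.continuous_ofReal.tendsto _).comp (hconv _)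
  · exact ge_of_tendsto' ((hS x).inner (𝕜 := ℂ) tendsto_const_nhds) fun p => hpos p x

theorem PosOp.isSymmetric {T : ℓ2 →L[ℂ] ℓ2} (hT : PosOp T) :
    (T : ℓ2 →ₗ[ℂ] ℓ2).IsSymmetric := by
  rw [LinearMap.isSymmetric_iff_inner_map_self_real]
  exact fun x => Complex.conj_eq_iff_im.2 (Complex.nonneg_iff.1 (hT x)).2.symm

theorem PosOp.abs_im_mul_le_norm_inner {T : ℓ2 →L[ℂ] ℓ2} (hT : PosOp T) (z : ℂ) (x : ℓ2) :
    ‖x‖ ^ 2 * |z.im| ≤ ‖⟪(T ^ 2 - z • 1 : ℓ2 →L[ℂ] ℓ2) x, x⟫‖ := by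
  have h : ⟪(T ^ 2 - z • 1 : ℓ2 →L[ℂ] ℓ2) x, x⟫ = ((‖T x‖ ^ 2 : ℝ) : ℂ) - starRingEnd ℂ z * (‖x‖ ^ 2 : ℝ) := by
    have h1 : ⟪T (T x), x⟫ = ⟪T x, T x⟫ := hT.isSymmetric (T x) x
    simp [pow_two T, h1, inner_self_eq_norm_sq_to_K, mul_comm]
  refine le_trans (le_of_eq ?_) (Complex.abs_im_le_norm _)
  rw [h, Complex.sub_im, Complex.ofReal_im, Complex.im_mul_ofReal, Complex.conj_im, zero_sub,
    neg_mul, neg_neg, abs_mul, abs_of_nonneg (sq_nonneg ‖x‖), mul_comm]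

theorem PosOp.isUnit_sq_sub_smul_one {T : ℓ2 →L[ℂ] ℓ2} (hT : PosOp T) {z : ℂ} (hz : z.im ≠ 0) :
    IsUnit (T ^ 2 - z • 1 : ℓ2 →L[ℂ] ℓ2) :=
  ContinuousLinearMap.isUnit_of_forall_le_norm_inner_map _ (c := ⟨|z.im|, abs_nonneg _⟩)
    (abs_pos.2 hz) (hT.abs_im_mul_le_norm_inner z)

theorem PosOp.abs_im_mul_norm_le {T : ℓ2 →L[ℂ] ℓ2} (hT : PosOp T) (z : ℂ) (x : ℓ2) :
    |z.im| * ‖x‖ ≤ ‖(T ^ 2 - z • 1 : ℓ2 →L[ℂ] ℓ2) x‖ := by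
  rcases (norm_nonneg x).eq_or_lt with hx | hx
  · rw [← hx, mul_zero]; exact norm_nonneg _
  · have := (hT.abs_im_mul_le_norm_inner z x).trans (norm_inner_le_norm _ _)
    exact le_of_mul_le_mul_right (by linarith) hx

theorem tendsto_resolvent_sq {T : ℕ → ℓ2 →L[ℂ] ℓ2} {S : ℓ2 →L[ℂ] ℓ2} {C : ℝ}
    (hC : ∀ p, ‖T p‖ ≤ C) (hT : ∀ p, PosOp (T p)) (hS : PosOp S)
    (hlim : ∀ x, Tendsto (fun p => T p x) atTop (nhds (S x))) {z : ℂ} (hz : z.im ≠ 0) (y : ℓ2) :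
    Tendsto (fun p => (Ring.inverse (T p ^ 2 - z • 1) : ℓ2 →L[ℂ] ℓ2) y) atTop
      (nhds ((Ring.inverse (S ^ 2 - z • 1) : ℓ2 →L[ℂ] ℓ2) y)) := by
  have hinv {A : ℓ2 →L[ℂ] ℓ2} (hA : IsUnit A) : A (Ring.inverse A y) = y := by
    rw [← mul_apply_eq_comp, Ring.mul_inverse_cancel _ hA,
      one_apply_eq_self]
  have hSy := hinv (hS.isUnit_sq_sub_smul_one hz)
  set u := (Ring.inverse (S ^ 2 - z • 1) : ℓ2 →L[ℂ] ℓ2) y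
  have hsq : Tendsto (fun p => T p (T p u)) atTop (nhds (S (S u))) := by
    have h1 : Tendsto (fun p => T p (T p u - S u)) atTop (nhds 0) := by
      have h0 := (tendsto_iff_norm_sub_tendsto_zero.1 (hlim u)).const_mul C
      rw [mul_zero] at h0
      exact squeeze_zero_norm (fun p => (T p).le_of_opNorm_le (hC p) _) h0
    simpa using h1.add (hlim (S u))
  have hbound (p : ℕ) : ‖(Ring.inverse (T p ^ 2 - z • 1) : ℓ2 →L[ℂ] ℓ2) y - u‖ ≤
      |z.im|⁻¹ * ‖T p (T p u) - S (S u)‖ := by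
    rw [inv_mul_eq_div, le_div_iff₀ (abs_pos.2 hz), mul_comm, norm_sub_rev (T p _)]
    refine ((hT p).abs_im_mul_norm_le z _).trans (le_of_eq (congrArg _ ?_))
    rw [map_sub, hinv ((hT p).isUnit_sq_sub_smul_one hz)]
    nth_rewrite 1 [← hSy]
    simp [pow_two]
  rw [tendsto_iff_norm_sub_tendsto_zero]
  have h0 := (tendsto_iff_norm_sub_tendsto_zero.1 hsq).const_mul |z.im|⁻¹
  rw [mul_zero] at h0
  exact squeeze_zero (fun _ => norm_nonneg _) hbound h0

theorem statement14 (R : ℝ) (hR : 0 < R)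
    (a : ℕ → ℕ → ℝ) (Γ ΓS : ℕ → (ℓ2 →L[ℂ] ℓ2))
    (hmem : ∀ p : ℕ, MemL1infPP (a p) (Γ p) (ΓS p))
    (hbd : ∀ p n : ℕ, (n + 1 : ℝ) * |a p n| ≤ R)
    (α : ℕ → ℝ)
    (hconv : ∀ n : ℕ,
      Filter.Tendsto (fun p => a p n) Filter.atTop (nhds (α n))) :
    ∃ Γα ΓαS : ℓ2 →L[ℂ] ℓ2, MemL1infPP α Γα ΓαS ∧
      (∀ x : ℓ2,
        Filter.Tendsto (fun p => Γ p x) Filter.atTop (nhds (Γα x))) ∧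
      (∀ x : ℓ2,
        Filter.Tendsto (fun p => ΓS p x) Filter.atTop (nhds (ΓαS x))) ∧
      ∀ z : ℂ, z.im ≠ 0 →
        Filter.Tendsto (fun p =>
            ⟪e 0, (Ring.inverse ((Γ p) ^ 2 - z • 1) : ℓ2 →L[ℂ] ℓ2) (e 0)⟫)
          Filter.atTop
          (nhds ⟪e 0, (Ring.inverse (Γα ^ 2 - z • 1) : ℓ2 →L[ℂ] ℓ2) (e 0)⟫) := by
  have hbdS (p n : ℕ) : (n + 1 : ℝ) * |a p (n + 1)| ≤ R := by
    refine le_trans ?_ (hbd p (n + 1))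
    push_cast
    gcongr
    linarith
  obtain ⟨Γα, hΓ, hΓpos, hΓlim⟩ := exists_strong_limit_hankel (fun p => (hmem p).2.1)
    (fun p => (hmem p).2.2.2.1) hbd hconv
  obtain ⟨ΓαS, hΓS, hΓSpos, hΓSlim⟩ := exists_strong_limit_hankel (fun p => (hmem p).2.2.1)
    (fun p => (hmem p).2.2.2.2) hbdS fun n => hconv (n + 1)
  refine ⟨Γα, ΓαS, ⟨⟨R, fun n => ?_⟩, hΓ, hΓS, hΓpos, hΓSpos⟩, hΓlim, hΓSlim, fun z hz => ?_⟩
  · exact le_of_tendsto' ((hconv n).abs.const_mul _) fun p => hbd p n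
  · exact tendsto_const_nhds.inner (tendsto_resolvent_sq
      (fun p => (hmem p).2.1.norm_le (hbd p)) (fun p => (hmem p).2.2.2.1) hΓpos hΓlim hz (e 0))
end
end
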